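/- For every integer n ≥ 1, the number of MVP parking functions of length n whose outcome is the decreasing permutation w_0 equals the n-th Motzkin number: |O_n^{-1}(w_0)| = ∑_{k=0}^{⌊n/2⌋} C(n, 2k) · catalan(k), where catalan(k) = C(2k,k)/(k+1) is the k-th Catalan number. -/

import Mathlib

open Finset

namespace MVPPark

/-- One step of the MVP parking process: car `c`, preferring spot `p`, arrives at the
state `state` (recording, for each spot, the car parked there, if any).  Car `c` always
parks in spot `p`; if spot `p` was occupied by an (earlier) car `j`, then `j` is bumped
and parks in the first unoccupied spot strictly beyond `p`, if such a spot exists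
(otherwise `j` drives off unparked). -/
def mvpStep {n : ℕ} (state : Fin n → Option (Fin n)) (c p : Fin n) :
    Fin n → Option (Fin n) :=
  match state p with
  | none => Function.update state p (some c)
  | some j =>
    match (List.finRange n).find? (fun k => decide (p < k) && (state k).isNone) with
    | none => Function.update state p (some c)
    | some k => Function.update (Function.update state p (some c)) k (some j)

/-- The final state of the MVP parking process with preference list `α`:
cars `0, 1, …, n-1` enter in order, car `i` preferring spot `α i`. -/
def mvpRun {n : ℕ} (α : Fin n → Fin n) : Fin n → Option (Fin n) :=
  (List.finRange n).foldl (fun st c => mvpStep st c (α c)) (fun _ => none)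

/-- `α` is an MVP parking function: under the MVP rule, all `n` cars end up parked. -/
def IsMVP {n : ℕ} (α : Fin n → Fin n) : Prop :=
  ∀ c : Fin n, ∃ j : Fin n, mvpRun α j = some c

/-- The outcome of the MVP parking process on `α` is the permutation `π`:
for each `j`, spot `j` ends up occupied by car `π j`. -/
def MvpOutcome {n : ℕ} (α : Fin n → Fin n) (π : Equiv.Perm (Fin n)) : Prop :=
  ∀ j : Fin n, mvpRun α j = some (π j)

end MVPPark

namespace MVPPark

/-- The `n`-th Motzkin number. -/
def motzkin (n : ℕ) : ℕ := ∑ k ∈ range (n / 2 + 1), n.choose (2 * k) * catalan k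

theorem motzkin_eq_sum_range {n K : ℕ} (h : n / 2 < K) :
    motzkin n = ∑ k ∈ range K, n.choose (2 * k) * catalan k := by
  refine sum_subset (range_subset_range.2 h) fun k _ hk => ?_
  rw [Nat.choose_eq_zero_of_lt (by simp at hk; omega), zero_mul]

theorem sum_antidiagonal_choose_mul_choose (n a b : ℕ) :
    ∑ ij ∈ antidiagonal n, ij.1.choose a * ij.2.choose b = (n + 1).choose (a + b + 1) := by
  induction n generalizing b with
  | zero => cases a <;> cases b <;> simp [Nat.choose_eq_zero_of_lt]
  | succ n ih =>
    rw [Nat.sum_antidiagonal_succ']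
    cases b with
    | zero =>
      have := ih 0
      simp only [Nat.choose_zero_right, mul_one, add_zero] at this ⊢
      rw [this, Nat.choose_succ_succ' (n + 1) a]
    | succ b =>
      simp only [Nat.choose_succ_succ' _ b, mul_add, sum_add_distrib, ih, Nat.choose_zero_succ]
      rw [← add_assoc a b 1, Nat.choose_succ_succ' (n + 1) (a + b + 1)]
      ring

theorem motzkin_succ (n : ℕ) :
    motzkin (n + 1) = motzkin n + ∑ i ∈ range n, motzkin i * motzkin (n - 1 - i) := by
  have hcat : motzkin (n + 1) =
      motzkin n + ∑ k ∈ range n, n.choose (2 * k + 1) * catalan (k + 1) := by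
    rw [motzkin_eq_sum_range (K := n + 1) (by omega), motzkin_eq_sum_range (K := n + 1) (by omega),
      sum_range_succ', sum_range_succ']
    simp only [mul_add, Nat.choose_succ_succ' n, mul_one, add_mul, sum_add_distrib]
    simp
    ring
  rw [hcat]
  congr 1
  cases n with
  | zero => simp
  | succ n =>
    have hprod : ∀ ij ∈ antidiagonal n, motzkin ij.1 * motzkin ij.2 =
        ∑ a ∈ range (n + 1), ∑ b ∈ range (n + 1),
          (ij.1.choose (2 * a) * ij.2.choose (2 * b)) * (catalan a * catalan b) := by
      intro ij hij
      rw [Finset.HasAntidiagonal.mem_antidiagonal] at hij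
      rw [motzkin_eq_sum_range (n := ij.1) (K := n + 1) (by omega),
        motzkin_eq_sum_range (n := ij.2) (K := n + 1) (by omega), sum_mul_sum]
      exact sum_congr rfl fun _ _ => sum_congr rfl fun _ _ => by ring
    rw [Nat.add_sub_cancel,
      ← Nat.sum_antidiagonal_eq_sum_range_succ (fun i j => motzkin i * motzkin j),
      sum_congr rfl hprod, sum_comm]
    simp_rw [sum_comm (s := antidiagonal n), ← sum_mul, sum_antidiagonal_choose_mul_choose]
    simp_rw [catalan_succ', mul_sum]
    rw [← sum_product', sum_sigma']
    refine sum_bij_ne_zero (fun x _ _ => x.2) ?_ ?_ ?_ ?_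
    · rintro ⟨k, a, b⟩ h _
      simp at h ⊢
      omega
    · rintro ⟨k, a, b⟩ h _ ⟨k', a', b'⟩ h' _ heq
      simp at h h' heq ⊢
      omega
    · rintro ⟨a, b⟩ h hne
      simp only [ne_eq, mul_eq_zero, not_or, Nat.choose_eq_zero_iff] at hne
      refine ⟨⟨a + b, a, b⟩, ?_, ?_, rfl⟩
      · simp
        omega
      · simp only [ne_eq, mul_eq_zero, not_or, Nat.choose_eq_zero_iff]
        exact ⟨by omega, hne.2⟩
    · rintro ⟨k, a, b⟩ h _
      simp at h
      obtain ⟨_, rfl⟩ := h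
      simp [mul_add]

/-- One more than the head of `L`, or `0` for the empty list. -/
def gapStart : List ℕ → ℕ
  | [] => 0
  | p :: _ => p + 1

/-- The product of the Motzkin numbers of the gaps below the entries of a decreasing list. -/
def gapProd : List ℕ → ℕ
  | [] => 1
  | p :: L => motzkin (p - gapStart L) * gapProd L

theorem gapProd_succ_cons_self (m : ℕ) (L : List ℕ) :
    gapProd ((m + 1) :: m :: L) = gapProd (m :: L) := by
  simp [gapProd, gapStart, motzkin]

theorem gapProd_succ_cons {m : ℕ} {L : List ℕ} (h : gapStart L ≤ m) :
    gapProd ((m + 1) :: L) =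
      gapProd (m :: L) + ∑ p ∈ Ico (gapStart L) m, gapProd (m :: p :: L) := by
  simp only [gapProd]
  rw [Nat.sub_add_comm h, motzkin_succ, add_mul, sum_Ico_eq_sum_range, sum_mul]
  congr 1
  refine sum_congr rfl fun i _ => ?_
  rw [gapStart, show m - (gapStart L + i + 1) = m - gapStart L - 1 - i by omega,
    Nat.add_sub_cancel_left]
  ring

variable {n : ℕ}

theorem mvpStep_cases (st : Fin n → Option (Fin n)) (c p : Fin n) :
    (st p = none ∧ mvpStep st c p p = some c ∧ ∀ x, x ≠ p → mvpStep st c p x = st x) ∨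
    (∃ j, st p = some j ∧ (∀ k, p < k → st k ≠ none) ∧
      mvpStep st c p p = some c ∧ ∀ x, x ≠ p → mvpStep st c p x = st x) ∨
    ∃ j k, st p = some j ∧ p < k ∧ st k = none ∧ (∀ l, p < l → l < k → st l ≠ none) ∧
      mvpStep st c p p = some c ∧ mvpStep st c p k = some j ∧
      ∀ x, x ≠ p → x ≠ k → mvpStep st c p x = st x := by
  unfold mvpStep
  rcases hp : st p with _ | j
  · simp +contextual
  · right
    rcases hf : (List.finRange n).find? (fun k => decide (p < k) && (st k).isNone) with _ | k
    · left
      simp only [List.find?_eq_none, List.mem_finRange, Bool.and_eq_true, decide_eq_true_eq,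
        Option.isNone_iff_eq_none, not_and, true_imp_iff] at hf
      exact ⟨j, rfl, hf, by simp, by simp +contextual⟩
    · right
      have hk := List.find?_some hf
      simp only [Bool.and_eq_true, decide_eq_true_eq, Option.isNone_iff_eq_none] at hk
      refine ⟨j, k, rfl, hk.1, hk.2, fun l hpl hlk hl => ?_, by simp [hk.1.ne], by simp,
        by simp +contextual⟩
      rw [List.find?_eq_some_iff_getElem] at hf
      obtain ⟨-, i, hi, hik, hmin⟩ := hf
      have hik : i = k.1 := by simp [← hik]
      have := hmin l.1 (by omega)
      simp [hl, hpl] at this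

/-- The state `st` parks only cars before car `t`, each at most once. -/
structure Reach (t : ℕ) (st : Fin n → Option (Fin n)) : Prop where
  lt : ∀ x j, st x = some j → j.1 < t
  inj : ∀ x y j, st x = some j → st y = some j → x = y

/-- The states from which the decreasing outcome can be reached: every car before `t` is parked,
either in its final spot or in one of the first `n - t` spots with its final spot still empty, and
the cars not in their final spot appear in increasing order. -/
structure Good (t : ℕ) (st : Fin n → Option (Fin n)) : Prop where
  pres : ∀ j : Fin n, j.1 < t → ∃ x, st x = some j
  final : ∀ x j : Fin n, st x = some j →
    x.1 + j.1 + 1 = n ∨ (x.1 + t < n ∧ ∀ y : Fin n, y.1 + j.1 + 1 = n → st y = none)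
  ord : ∀ x j x' j' : Fin n, st x = some j → st x' = some j' →
    x.1 + j.1 + 1 ≠ n → x'.1 + j'.1 + 1 ≠ n → j < j' → x < x'

theorem Reach.step {st : Fin n → Option (Fin n)} {c : Fin n} (h : Reach c.1 st) (p : Fin n) :
    Reach (c.1 + 1) (mvpStep st c p) := by
  obtain ⟨hlt, hinj⟩ := h
  rcases mvpStep_cases st c p with ⟨h1, h2, h3⟩ | ⟨j, h1, h2, h3, h4⟩ |
    ⟨j, k, h1, h2, h3, h4, h5, h6, h7⟩ <;> generalize mvpStep st c p = s at *
  · constructor <;> grind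
  · constructor <;> grind
  · constructor <;> grind

theorem Good.of_step {st : Fin n → Option (Fin n)} {c p : Fin n} (hr : Reach c.1 st)
    (h : Good (c.1 + 1) (mvpStep st c p)) : Good c.1 st := by
  obtain ⟨hlt, hinj⟩ := hr
  obtain ⟨pres, final, ord⟩ := h
  have hrev : c.rev.1 + c.1 + 1 = n := by rw [Fin.val_rev]; omega
  rcases mvpStep_cases st c p with ⟨h1, h2, h3⟩ | ⟨j, h1, h2, h3, h4⟩ |
    ⟨j, k, h1, h2, h3, h4, h5, h6, h7⟩ <;> generalize mvpStep st c p = s at *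
  · have hs : ∀ x i, st x = some i → s x = some i := by grind
    have hnone : ∀ x, s x = none → st x = none := by grind
    refine ⟨fun i hi => ?_, fun x i hx => ?_, fun x i x' i' hx hx' => ?_⟩
    · obtain ⟨x, hx⟩ := pres i (by omega)
      exact ⟨x, by grind⟩
    · exact (final x i (hs x i hx)).imp_right fun h => ⟨by omega, fun y hy => hnone y (h.2 y hy)⟩
    · exact ord x i x' i' (hs x i hx) (hs x' i' hx')
  · obtain ⟨x, hx⟩ := pres j (by have := hlt p j h1; omega)
    grind
  · have hjc := hlt p j h1
    have hnone : ∀ x, s x = none → st x = none := by grind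
    have hp : p.1 + c.1 + 1 = n := by
      by_contra hne
      have hfc := ((final p c h5).resolve_left hne)
      have hsc := hfc.2 c.rev hrev
      have hk : k < c.rev := by grind
      have := ord k j p c h6 h5 (by omega) hne hjc
      omega
    have hk : k.1 + j.1 + 1 = n := (final k j h6).resolve_right (by omega)
    have hs : ∀ x i, st x = some i → x ≠ p → s x = some i := by grind
    refine ⟨fun i hi => ?_, fun x i hx => ?_, fun x i x' i' hx hx' hxi hxi' hii' => ?_⟩
    · obtain ⟨x, hx⟩ := pres i (by omega)
      by_cases hij : i = j
      · exact ⟨p, by rw [h1, hij]⟩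
      · exact ⟨x, by grind⟩
    · by_cases hxp : x = p
      · obtain rfl : j = i := by grind
        refine .inr ⟨by omega, fun y hy => ?_⟩
        obtain rfl : y = k := by omega
        exact h3
      · exact (final x i (hs x i hx hxp)).imp_right
          fun h => ⟨by omega, fun y hy => hnone y (h.2 y hy)⟩
    · by_cases hxp : x = p
      · obtain rfl : j = i := by grind
        have hx'p : x' ≠ p := by grind
        have hf := ((final x' i' (hs x' i' hx' hx'p)).resolve_left hxi').2
        have hrev' : i'.rev.1 + i'.1 + 1 = n := by rw [Fin.val_rev]; omega
        have hi' := hlt x' i' hx'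
        exact absurd (hnone _ (hf _ hrev')) (h4 _ (by omega) (by omega))
      · by_cases hx'p : x' = p
        · have := (final x i (hs x i hx hxp)).resolve_left hxi
          omega
        · exact ord x i x' i' (hs x i hx hxp) (hs x' i' hx' hx'p) hxi hxi' hii'

theorem Good.step_rev {st : Fin n → Option (Fin n)} {c : Fin n} (hr : Reach c.1 st)
    (h : Good c.1 st) : Good (c.1 + 1) (mvpStep st c c.rev) := by
  obtain ⟨hlt, hinj⟩ := hr
  obtain ⟨pres, final, ord⟩ := h
  have hrev : c.rev.1 + c.1 + 1 = n := by rw [Fin.val_rev]; omega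
  generalize c.rev = p at *
  rcases mvpStep_cases st c p with ⟨h1, h2, h3⟩ | ⟨j, h1, h2, h3, h4⟩ |
    ⟨j, k, h1, h2, h3, h4, h5, h6, h7⟩ <;> generalize mvpStep st c p = s at *
  · have hs : ∀ x i, s x = some i → x ≠ p → st x = some i := by grind
    refine ⟨fun i hi => ?_, fun x i hx => ?_, fun x i x' i' hx hx' hxi hxi' hii' => ?_⟩
    · by_cases hic : i = c
      · exact ⟨p, by rw [h2, hic]⟩
      · obtain ⟨x, hx⟩ := pres i (by omega)
        exact ⟨x, by grind⟩
    · by_cases hxp : x = p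
      · left
        grind
      · have hsx := hs x i hx hxp
        have hic := hlt x i hsx
        refine (final x i hsx).imp_right fun h => ⟨by omega, fun y hy => ?_⟩
        rw [h3 y (by rintro rfl; omega)]
        exact h.2 y hy
    · have hxp : x ≠ p := by rintro rfl; grind
      have hxp' : x' ≠ p := by rintro rfl; grind
      exact ord x i x' i' (hs x i hx hxp) (hs x' i' hx' hxp') hxi hxi' hii'
  · have hrev' : j.rev.1 + j.1 + 1 = n := by rw [Fin.val_rev]; omega
    have hjc := hlt p j h1
    exact absurd (((final p j h1).resolve_left (by omega)).2 _ hrev') (h2 _ (by omega))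
  · have hrev' : j.rev.1 + j.1 + 1 = n := by rw [Fin.val_rev]; omega
    have hrev'' : k.rev.1 + k.1 + 1 = n := by rw [Fin.val_rev]; omega
    have hjc := hlt p j h1
    have hfj := ((final p j h1).resolve_left (by omega)).2
    have hk : k.1 + j.1 + 1 = n := by
      by_contra hne
      have hkj : k < j.rev := by
        by_contra hcon
        exact h4 j.rev (by omega) (by omega) (hfj _ hrev')
      obtain ⟨x, hx⟩ := pres k.rev (by omega)
      have hxk : x ≠ k := by grind
      have hxf : x.1 + k.rev.1 + 1 ≠ n := by omega
      have := (final x _ hx).resolve_left hxf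
      have := ord p j x _ h1 hx (by omega) hxf (by omega)
      omega
    have hs : ∀ x i, s x = some i → x ≠ p → x ≠ k → st x = some i := by grind
    refine ⟨fun i hi => ?_, fun x i hx => ?_, fun x i x' i' hx hx' hxi hxi' hii' => ?_⟩
    · by_cases hic : i = c
      · exact ⟨p, by rw [h5, hic]⟩
      · by_cases hij : i = j
        · exact ⟨k, by rw [h6, hij]⟩
        · obtain ⟨x, hx⟩ := pres i (by omega)
          exact ⟨x, by grind⟩
    · by_cases hxp : x = p
      · left
        grind
      · by_cases hxk : x = k
        · left
          grind
        · have hsx := hs x i hx hxp hxk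
          have hic := hlt x i hsx
          refine (final x i hsx).imp_right fun h => ⟨by omega, fun y hy => ?_⟩
          have hij : i ≠ j := by
            rintro rfl
            exact hxp (hinj _ _ _ hsx h1)
          rw [h7 y (by rintro rfl; omega) (by rintro rfl; omega)]
          exact h.2 y hy
    · have hxp : x ≠ p := by rintro rfl; grind
      have hxp' : x' ≠ p := by rintro rfl; grind
      have hxk : x ≠ k := by rintro rfl; grind
      have hxk' : x' ≠ k := by rintro rfl; grind
      exact ord x i x' i' (hs x i hx hxp hxk) (hs x' i' hx' hxp' hxk') hxi hxi' hii'

theorem Good.step_of_lt {st : Fin n → Option (Fin n)} {c p : Fin n} (hr : Reach c.1 st)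
    (h : Good c.1 st) (hp : p < c.rev) (hc : st c.rev = none)
    (hx : ∀ x, x < c.rev → st x ≠ none → x < p) : Good (c.1 + 1) (mvpStep st c p) := by
  obtain ⟨hlt, hinj⟩ := hr
  obtain ⟨pres, final, ord⟩ := h
  have hrev : c.rev.1 + c.1 + 1 = n := by rw [Fin.val_rev]; omega
  have hstp : st p = none := by
    by_contra hne
    exact lt_irrefl _ (hx p hp hne)
  rcases mvpStep_cases st c p with ⟨-, h2, h3⟩ | ⟨j, h1, -⟩ | ⟨j, k, h1, -⟩
  · generalize mvpStep st c p = s at *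
    have hs : ∀ x i, s x = some i → x ≠ p → st x = some i := by grind
    have hpend : ∀ x i, st x = some i → x.1 + i.1 + 1 ≠ n → x < p := by
      intro x i hxi hne
      have := (final x i hxi).resolve_left hne
      refine hx x (lt_of_le_of_ne (by omega) ?_) (by simp [hxi])
      rintro rfl
      simp [hc] at hxi
    refine ⟨fun i hi => ?_, fun x i hx => ?_, fun x i x' i' hx hx' hxi hxi' hii' => ?_⟩
    · by_cases hic : i = c
      · exact ⟨p, by rw [h2, hic]⟩
      · obtain ⟨x, hx⟩ := pres i (by omega)
        exact ⟨x, by grind⟩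
    · by_cases hxp : x = p
      · obtain rfl : c = i := by grind
        refine .inr ⟨by omega, fun y hy => ?_⟩
        obtain rfl : y = c.rev := by omega
        rw [h3 _ (by omega), hc]
      · have hsx := hs x i hx hxp
        have hic := hlt x i hsx
        by_cases hne : x.1 + i.1 + 1 = n
        · exact .inl hne
        have := hpend x i hsx hne
        refine .inr ⟨by omega, fun y hy => ?_⟩
        rw [h3 y (by rintro rfl; omega)]
        exact ((final x i hsx).resolve_left hne).2 y hy
    · by_cases hxp : x = p
      · obtain rfl : c = i := by grind
        have := hlt x' i' (hs x' i' hx' (by grind))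
        omega
      · by_cases hxp' : x' = p
        · rw [hxp']
          exact hpend x i (hs x i hx hxp) hxi
        · exact ord x i x' i' (hs x i hx hxp) (hs x' i' hx' hxp') hxi hxi' hii'
  · simp [hstp] at h1
  · simp [hstp] at h1

theorem Good.eq_rev_or_lt {st : Fin n → Option (Fin n)} {c p : Fin n} (hr : Reach c.1 st)
    (h : Good (c.1 + 1) (mvpStep st c p)) :
    p = c.rev ∨ (p < c.rev ∧ st c.rev = none ∧ ∀ x, x < c.rev → st x ≠ none → x < p) := by
  obtain ⟨hlt, -⟩ := hr
  obtain ⟨-, final, ord⟩ := h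
  have hrev : c.rev.1 + c.1 + 1 = n := by rw [Fin.val_rev]; omega
  refine or_iff_not_imp_left.2 fun hne => ?_
  have hpc : p.1 + c.1 + 1 ≠ n := fun hcon => hne (by omega)
  rcases mvpStep_cases st c p with ⟨h1, h2, h3⟩ | ⟨j, h1, h2, h3, h4⟩ |
    ⟨j, k, h1, h2, h3, h4, h5, h6, h7⟩ <;> generalize mvpStep st c p = s at *
  · obtain ⟨hp, hfc⟩ := (final p c h2).resolve_left hpc
    have hc : st c.rev = none := by
      rw [← h3 _ (Ne.symm hne)]
      exact hfc _ hrev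
    refine ⟨by omega, hc, fun x hx hxne => ?_⟩
    obtain ⟨i, hi⟩ := Option.ne_none_iff_exists'.1 hxne
    have hic := hlt x i hi
    have hsx : s x = some i := by grind
    exact ord x i p c hsx h2 (by omega) hpc hic
  · obtain ⟨hp, hfc⟩ := (final p c h3).resolve_left hpc
    have := hfc _ hrev
    rw [h4 _ (Ne.symm hne)] at this
    exact absurd this (h2 _ (by omega))
  · obtain ⟨hp, hfc⟩ := (final p c h5).resolve_left hpc
    have hsc := hfc _ hrev
    have hk : k < c.rev := by grind
    have hjc := hlt p j h1
    have := ord k j p c h6 h5 (by omega) hpc hjc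
    omega

/-- The number of preference tuples of the cars `f 0, f 1, …` that lead from the state `st` to
the decreasing outcome. -/
def completions (m : ℕ) (f : Fin m → Fin n) (st : Fin n → Option (Fin n)) : ℕ :=
  ∑ α : Fin m → Fin n,
    if ∀ j, (List.finRange m).foldl (fun s i => mvpStep s (f i) (α i)) st j = some j.rev
    then 1 else 0

theorem completions_succ (m : ℕ) (f : Fin (m + 1) → Fin n) (st : Fin n → Option (Fin n)) :
    completions (m + 1) f st =
      ∑ p, completions m (fun i => f i.succ) (mvpStep st (f 0) p) := by
  unfold completions
  rw [← (Fin.consEquiv fun _ : Fin (m + 1) => Fin n).sum_comp, Fintype.sum_prod_type]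
  simp [Fin.consEquiv, List.finRange_succ, List.foldl_map]

theorem Good.of_completions_ne_zero {m : ℕ} {f : Fin m → Fin n} {t : ℕ} (hm : t + m = n)
    (hf : ∀ i, (f i).1 = t + i.1) {st : Fin n → Option (Fin n)} (hr : Reach t st)
    (h : completions m f st ≠ 0) : Good t st := by
  induction m generalizing t st with
  | zero =>
    have hst : ∀ j, st j = some j.rev := by
      by_contra hcon
      simp [completions, hcon] at h
    constructor
    · exact fun j _ => ⟨j.rev, by rw [hst, Fin.rev_rev]⟩
    · intro x j hx
      rw [hst] at hx
      left
      rw [← Option.some.inj hx, Fin.val_rev]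
      omega
    · intro x j x' j' hx _ hne
      rw [hst] at hx
      rw [← Option.some.inj hx, Fin.val_rev] at hne
      omega
  | succ m ih =>
    rw [completions_succ] at h
    obtain ⟨p, -, hp⟩ := exists_ne_zero_of_sum_ne_zero h
    obtain rfl : (f 0).1 = t := by simp [hf]
    have hf' : ∀ i : Fin m, (f i.succ).1 = (f 0).1 + 1 + i.1 := fun i => by
      rw [hf, hf, Fin.val_succ, Fin.val_zero]
      omega
    exact .of_step hr (ih (by omega) hf' (hr.step p) hp)

theorem completions_eq_gapProd {m : ℕ} {f : Fin m → Fin n} {t : ℕ} (hm : t + m = n)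
    (hf : ∀ i, (f i).1 = t + i.1) {st : Fin n → Option (Fin n)} (hr : Reach t st)
    (h : Good t st) {L : List ℕ} (hL : L.Pairwise (· > ·))
    (hmem : ∀ x, x ∈ L ↔ x < m ∧ ∃ y : Fin n, y.1 = x ∧ st y ≠ none) :
    completions m f st = gapProd (m :: L) := by
  induction m generalizing t st L with
  | zero =>
    obtain rfl : L = [] := List.eq_nil_iff_forall_not_mem.2 fun x => by simp [hmem]
    have hst : ∀ j, st j = some j.rev := by
      intro j
      obtain ⟨x, hx⟩ := h.pres j.rev (by omega)
      have := h.final x _ hx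
      rw [Fin.val_rev] at this
      obtain rfl : x = j := by omega
      exact hx
    simp [completions, hst, gapProd, gapStart, motzkin]
  | succ m ih =>
    rw [completions_succ]
    obtain rfl : (f 0).1 = t := by simp [hf]
    set c := f 0
    have hc : c.rev.1 = m := by rw [Fin.val_rev]; omega
    have hf' : ∀ i : Fin m, (f i.succ).1 = c.1 + 1 + i.1 := fun i => by
      rw [hf, hf, Fin.val_succ, Fin.val_zero]
      omega
    have key : ∀ p, Good (c.1 + 1) (mvpStep st c p) → ∀ L' : List ℕ, L'.Pairwise (· > ·) →
        (∀ x, x ∈ L' ↔ x < m ∧ ∃ y : Fin n, y.1 = x ∧ mvpStep st c p y ≠ none) →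
        completions m (fun i => f i.succ) (mvpStep st c p) = gapProd (m :: L') :=
      fun p hg L' h1 h2 => ih (by omega) hf' (hr.step p) hg h1 h2
    have hzero : ∀ p, ¬ (p = c.rev ∨
        (p < c.rev ∧ st c.rev = none ∧ ∀ x, x < c.rev → st x ≠ none → x < p)) →
        completions m (fun i => f i.succ) (mvpStep st c p) = 0 := fun p hp => by
      by_contra hne
      exact hp ((Good.of_completions_ne_zero (by omega) hf' (hr.step p) hne).eq_rev_or_lt hr)
    have hlow : ∀ y : Fin n, y < c.rev → mvpStep st c c.rev y = st y := by
      intro y hy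
      rcases mvpStep_cases st c c.rev with ⟨-, -, h⟩ | ⟨j, -, -, -, h⟩ |
        ⟨j, k, -, hk, -, -, -, -, h⟩
      · exact h y hy.ne
      · exact h y hy.ne
      · exact h y hy.ne (hy.trans hk).ne
    have hmem_iff : ∀ y : Fin n, y.1 ∈ L ↔ y.1 < m + 1 ∧ st y ≠ none := by
      intro y
      rw [hmem]
      refine and_congr_right fun _ => ⟨?_, fun hy => ⟨y, rfl, hy⟩⟩
      rintro ⟨z, hz, hy⟩
      rwa [← Fin.ext hz]
    have hlt : ∀ x ∈ L, x < m + 1 := fun x hx => ((hmem x).1 hx).1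
    by_cases hmL : m ∈ L
    · obtain ⟨L', rfl⟩ : ∃ L', L = m :: L' := by
        cases L with
        | nil => simp at hmL
        | cons a L =>
          rw [List.pairwise_cons] at hL
          have := hlt a (by simp)
          rcases List.mem_cons.1 hmL with rfl | hm'
          · exact ⟨L, rfl⟩
          · have := hL.1 m hm'
            omega
      rw [List.pairwise_cons] at hL
      have hocc : st c.rev ≠ none := ((hmem_iff c.rev).1 (by rw [hc]; simp)).2
      rw [gapProd_succ_cons_self, sum_eq_single c.rev (fun p _ hp => hzero p (by tauto)) (by simp),
        key _ (h.step_rev hr) L' hL.2]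
      intro x
      have hx := hmem x
      constructor
      · intro hxL
        have hxm := hL.1 x hxL
        obtain ⟨-, y, rfl, hy⟩ := hx.1 (by simp [hxL])
        refine ⟨hxm, y, rfl, ?_⟩
        rwa [hlow y (by omega)]
      · rintro ⟨hxm, y, rfl, hy⟩
        rw [hlow y (by omega)] at hy
        have := (hmem_iff y).2 ⟨by omega, hy⟩
        rcases List.mem_cons.1 this with h1 | h1
        · omega
        · exact h1
    · have hnone : st c.rev = none := by
        by_contra hne
        exact hmL (hc ▸ (hmem_iff c.rev).2 ⟨by omega, hne⟩)
      have hlt' : ∀ x ∈ L, x < m := fun x hx => by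
        have := hlt x hx
        have : x ≠ m := fun h => hmL (h ▸ hx)
        omega
      have hstart : gapStart L ≤ m := by
        cases L with
        | nil => simp [gapStart]
        | cons a L => exact hlt' a (by simp)
      have hstart_iff : ∀ p, gapStart L ≤ p ↔ ∀ x ∈ L, x < p := by
        intro p
        cases L with
        | nil => simp [gapStart]
        | cons a L =>
          rw [List.pairwise_cons] at hL
          refine ⟨fun hp x hx => ?_, fun hp => hp a (by simp)⟩
          have hp : a + 1 ≤ p := hp
          rcases List.mem_cons.1 hx with rfl | hx
          · omega
          · have := hL.1 x hx
            omega
      have hbelow : ∀ p : Fin n, (∀ x, x < c.rev → st x ≠ none → x < p) ↔ ∀ x ∈ L, x < p.1 := by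
        intro p
        constructor
        · intro hp x hx
          obtain ⟨-, y, rfl, hy⟩ := (hmem x).1 hx
          exact hp y (by have := hlt' _ hx; omega) hy
        · exact fun hp x hx hne => hp x ((hmem_iff x).2 ⟨by omega, hne⟩)
      rw [gapProd_succ_cons hstart, ← add_sum_erase _ _ (mem_univ c.rev)]
      congr 1
      · refine key _ (h.step_rev hr) L hL fun x => ⟨fun hx => ?_, ?_⟩
        · obtain ⟨-, y, rfl, hy⟩ := (hmem x).1 hx
          have := hlt' _ hx
          exact ⟨this, y, rfl, by rwa [hlow y (by omega)]⟩
        · rintro ⟨hxm, y, rfl, hy⟩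
          rw [hlow y (by omega)] at hy
          exact (hmem_iff y).2 ⟨by omega, hy⟩
      · have hval : ∀ p : Fin n, gapStart L ≤ p.1 → p.1 < m →
            completions m (fun i => f i.succ) (mvpStep st c p) = gapProd (m :: p.1 :: L) := by
          intro p hp hpm
          have hpL := (hstart_iff p.1).1 hp
          have hpnone : st p = none := by
            by_contra hne
            exact lt_irrefl _ (hpL p.1 ((hmem_iff p).2 ⟨by omega, hne⟩))
          refine key _ (h.step_of_lt hr (by omega) hnone ((hbelow p).2 hpL)) _
            (List.pairwise_cons.2 ⟨hpL, hL⟩) fun x => ?_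
          have hstep : mvpStep st c p = Function.update st p (some c) := by
            simp [mvpStep, hpnone]
          rw [hstep, List.mem_cons]
          constructor
          · rintro (rfl | hx)
            · exact ⟨hpm, p, rfl, by simp⟩
            · obtain ⟨-, y, rfl, hy⟩ := (hmem x).1 hx
              have hyp : y ≠ p := by
                rintro rfl
                exact hy hpnone
              exact ⟨hlt' _ hx, y, rfl, by rwa [Function.update_of_ne hyp]⟩
          · rintro ⟨hxm, y, rfl, hy⟩
            by_cases hyp : y = p
            · exact .inl (congrArg _ hyp)
            · rw [Function.update_of_ne hyp] at hy
              exact .inr ((hmem_iff y).2 ⟨by omega, hy⟩)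
        symm
        refine sum_bij_ne_zero (fun p hp _ => ⟨p, by simp at hp; omega⟩) ?_ ?_ ?_ ?_
        · intro p hp _
          simp at hp
          simp [Fin.ext_iff]
          omega
        · intro p hp _ q hq _ hpq
          simpa using hpq
        · intro p hp hne
          have hpc : p ≠ c.rev := by simpa using hp
          obtain ⟨h1, -, h2⟩ : p < c.rev ∧ st c.rev = none ∧
              ∀ x, x < c.rev → st x ≠ none → x < p := by
            by_contra hcon
            exact hne (hzero p (by tauto))
          have hpm : p.1 < m := by omega
          have hp' := (hstart_iff p.1).2 ((hbelow p).1 h2)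
          exact ⟨p.1, mem_Ico.2 ⟨hp', hpm⟩, by rwa [← hval p hp' hpm], rfl⟩
        · intro p hp _
          rw [mem_Ico] at hp
          exact (hval ⟨p, by omega⟩ hp.1 hp.2).symm

end MVPPark

open MVPPark in
/-- The number of MVP parking functions whose outcome is the decreasing permutation
`w₀` (spot `j` gets car `j.rev`, i.e. car `n - j + 1` in `1`-indexed terms) is the
`n`-th Motzkin number `∑_{k=0}^{⌊n/2⌋} C(n, 2k)·catalan(k)`. -/
theorem fiber_w0_eq_motzkin (n : ℕ) (hn : 1 ≤ n) :
    Nat.card {α : Fin n → Fin n // ∀ j : Fin n, mvpRun α j = some j.rev} =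
      ∑ k ∈ Finset.range (n / 2 + 1), n.choose (2 * k) * catalan k := by
  have hcount := completions_eq_gapProd (n := n) (m := n) (f := id) (t := 0) (by omega) (by simp)
    (st := fun _ => none) ⟨by simp, by simp⟩ ⟨by simp, by simp, by simp⟩ (L := [])
    List.Pairwise.nil (by simp)
  rw [Nat.card_eq_fintype_card, Fintype.card_subtype]
  simp only [completions, id, sum_boole, Nat.cast_id, gapProd, gapStart, mul_one, Nat.sub_zero]
    at hcount
  convert hcount
  · rfl
  · rfl
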